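/- Let A ∈ ℝ^{n×n} and B ∈ ℝ^{m×m} be symmetric matrices and C ∈ ℝ^{m×n}. If the block matrix W = [[A, 0],[C, B]] satisfies B B† C A† A = C (equivalently C decomposes appropriately through the ranges of A and B), and A, B are such that A and B are symmetric, then the Moore–Penrose inverse of W is W† = [[A†, 0],[−B† C A†, B†]]. -/

import Mathlib

open Matrix

/-- Moore–Penrose inverse predicate: the four Penrose conditions. -/
def IsPinv {k l : Type*} [Fintype k] [Fintype l]
    (A : Matrix k l ℝ) (B : Matrix l k ℝ) : Prop :=
  A * B * A = A ∧ B * A * B = B ∧ (A * B)ᵀ = A * B ∧ (B * A)ᵀ = B * A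

theorem stmt6 (n m : ℕ) (A : Matrix (Fin n) (Fin n) ℝ) (B : Matrix (Fin m) (Fin m) ℝ)
    (C : Matrix (Fin m) (Fin n) ℝ) (hA : A.IsSymm) (hB : B.IsSymm)
    (Ad : Matrix (Fin n) (Fin n) ℝ) (hAd : IsPinv A Ad)
    (Bd : Matrix (Fin m) (Fin m) ℝ) (hBd : IsPinv B Bd)
    (hC : B * Bd * C * Ad * A = C) :
    IsPinv (Matrix.fromBlocks A 0 C B)
      (Matrix.fromBlocks Ad 0 (-(Bd * C * Ad)) Bd) := by
  obtain ⟨a1, a2, a3, a4⟩ := hAd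
  obtain ⟨b1, b2, b3, b4⟩ := hBd
  have h1 : B * Bd * C = C := by
    calc B * Bd * C = B * Bd * (B * Bd * C * Ad * A) := by rw [hC]
      _ = (B * Bd * B) * Bd * C * Ad * A := by simp only [Matrix.mul_assoc]
      _ = C := by rw [b1, hC]
  have h2 : C * Ad * A = C := by
    calc C * Ad * A = (B * Bd * C) * Ad * A := by rw [h1]
      _ = C := hC
  have e1 : Matrix.fromBlocks A 0 C B * Matrix.fromBlocks Ad 0 (-(Bd * C * Ad)) Bd
      = Matrix.fromBlocks (A * Ad) 0 0 (B * Bd) := by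
    have h : B * (Bd * C * Ad) = C * Ad := by
      rw [← Matrix.mul_assoc, ← Matrix.mul_assoc, h1]
    simp [Matrix.fromBlocks_multiply, h]
  have e2 : Matrix.fromBlocks Ad 0 (-(Bd * C * Ad)) Bd * Matrix.fromBlocks A 0 C B
      = Matrix.fromBlocks (Ad * A) 0 0 (Bd * B) := by
    have h : Bd * C * Ad * A = Bd * C := by
      rw [Matrix.mul_assoc Bd, Matrix.mul_assoc Bd, h2]
    simp [Matrix.fromBlocks_multiply, h]
  refine ⟨?_, ?_, ?_, ?_⟩
  · rw [e1]
    simp [Matrix.fromBlocks_multiply, a1, b1, h1]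
  · rw [e2]
    have h : Bd * B * (Bd * C * Ad) = Bd * C * Ad := by
      rw [← Matrix.mul_assoc, ← Matrix.mul_assoc, b2]
    simp [Matrix.fromBlocks_multiply, a2, b2, h]
  · rw [e1, Matrix.fromBlocks_transpose, a3, b3]
    simp
  · rw [e2, Matrix.fromBlocks_transpose, a4, b4]
    simp
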